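/- arXiv:2110.04723 — 2 statements merged into one kernel-verified Lean document; each statement's English description precedes it below -/
import Mathlib

section
/- If u and v are permutations in S_n with the same odd diagram, then u^{-1}(i) ≡ v^{-1}(i) (mod 2) for all 1 ≤ i ≤ n; that is, each value appears in positions of the same parity in u and in v. -/
open Equiv Finset Polynomial

/-- The odd diagram of a permutation of `Fin n` (0-based positions and values):
boxes `(i, j)` with `w i > j`, `i < w⁻¹ j`, and `i`, `w⁻¹ j` of different parity. -/
def oddDiagram {n : ℕ} (w : Equiv.Perm (Fin n)) : Set (Fin n × Fin n) :=
  {p | p.2 < w p.1 ∧ p.1 < w⁻¹ p.2 ∧ ((p.1 : ℕ) % 2 ≠ ((w⁻¹ p.2 : Fin n) : ℕ) % 2)}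

/-- The Bruhat order on `S_n`: the reflexive-transitive closure of the relations
`x < x * (i j)` whenever `i < j` and `x i < x j`. -/
def bruhatLE {n : ℕ} : Equiv.Perm (Fin n) → Equiv.Perm (Fin n) → Prop :=
  Relation.ReflTransGen (fun x y => ∃ i j : Fin n, i < j ∧ x i < x j ∧ y = x * Equiv.swap i j)

/-- Strict Bruhat order. -/
def bruhatLT {n : ℕ} (x y : Equiv.Perm (Fin n)) : Prop := bruhatLE x y ∧ x ≠ y

/-- The Coxeter length of a permutation, i.e. its number of inversions. -/
def invLength {n : ℕ} (w : Equiv.Perm (Fin n)) : ℕ :=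
  (Finset.univ.filter (fun p : Fin n × Fin n => p.1 < p.2 ∧ w p.2 < w p.1)).card

/-- If `x` sends every element of a finite set `T` of positions to a value other than `j`, while
`y` attains `j` on `T`, then some value taken by `x` on `T` is taken by `y` outside `T`. -/
lemma exists_inv_apply_notMem {n : ℕ} (x y : Equiv.Perm (Fin n)) (T : Finset (Fin n)) (j : Fin n)
    (hx : ∀ i ∈ T, x i ≠ j) (hy : y⁻¹ j ∈ T) : ∃ i ∈ T, y⁻¹ (x i) ∉ T := by
  by_contra! h
  have hsurj : Set.SurjOn (fun i => y⁻¹ (x i)) (T : Set (Fin n)) T :=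
    Finset.surjOn_of_injOn_of_card_le _ (fun i hi => h i hi)
      (fun a _ b _ hab => x.injective (y⁻¹.injective hab)) le_rfl
  obtain ⟨i, hi, hij⟩ := hsurj hy
  exact hx i hi (y⁻¹.injective hij)

/-- If `j` has positions of different parity in `x` and `y`, but smaller values do not, then `x`
takes a value at least `j` at some position of the parity of `y⁻¹ j`. -/
lemma exists_le_apply_of_parity {n : ℕ} (x y : Equiv.Perm (Fin n)) (j : Fin n)
    (ih : ∀ k < j, ((x⁻¹ k : Fin n) : ℕ) % 2 = ((y⁻¹ k : Fin n) : ℕ) % 2) :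
    ∃ i : Fin n, (i : ℕ) % 2 = ((y⁻¹ j : Fin n) : ℕ) % 2 ∧ j ≤ x i := by
  by_contra! h
  obtain ⟨i, hi, hni⟩ := exists_inv_apply_notMem x y
    (Finset.univ.filter fun i : Fin n => (i : ℕ) % 2 = ((y⁻¹ j : Fin n) : ℕ) % 2) j
    (fun i hi => (h i (Finset.mem_filter.1 hi).2).ne) (by simp)
  simp only [Finset.mem_filter, Finset.mem_univ, true_and] at hi hni
  have := ih (x i) (h i hi)
  rw [show x⁻¹ (x i) = i from x.symm_apply_apply i] at this
  exact hni (this ▸ hi)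

lemma mem_oddDiagram {n : ℕ} {w : Equiv.Perm (Fin n)} {i j : Fin n} :
    (i, j) ∈ oddDiagram w ↔
      j < w i ∧ i < w⁻¹ j ∧ (i : ℕ) % 2 ≠ ((w⁻¹ j : Fin n) : ℕ) % 2 := Iff.rfl

/-- If `j` has positions of different parity in `u` and `v`, its column in a common odd diagram is
empty, so large values of `u` of the other parity lie after `j`. -/
lemma inv_lt_of_le_apply {n : ℕ} {u v : Equiv.Perm (Fin n)} (hD : oddDiagram u = oddDiagram v)
    {j a : Fin n} (hj : ((u⁻¹ j : Fin n) : ℕ) % 2 ≠ ((v⁻¹ j : Fin n) : ℕ) % 2)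
    (hpar : (a : ℕ) % 2 = ((v⁻¹ j : Fin n) : ℕ) % 2) (ha : j ≤ u a) : u⁻¹ j < a := by
  by_contra! hle
  have hne : a ≠ u⁻¹ j := by rintro rfl; exact hj hpar
  have hua : j ≠ u a := by rintro rfl; simp at hne
  have hmem : (a, j) ∈ oddDiagram u :=
    mem_oddDiagram.2 ⟨lt_of_le_of_ne ha hua, lt_of_le_of_ne hle hne, by omega⟩
  rw [hD] at hmem
  exact (mem_oddDiagram.1 hmem).2.2 hpar

lemma exists_apply_ge_before {n : ℕ} {u v : Equiv.Perm (Fin n)}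
    (hD : oddDiagram u = oddDiagram v) {j a : Fin n}
    (ih : ∀ k < j, ((u⁻¹ k : Fin n) : ℕ) % 2 = ((v⁻¹ k : Fin n) : ℕ) % 2)
    (hj : ((u⁻¹ j : Fin n) : ℕ) % 2 ≠ ((v⁻¹ j : Fin n) : ℕ) % 2)
    (hpar : (a : ℕ) % 2 = ((v⁻¹ j : Fin n) : ℕ) % 2) (ha : j ≤ u a) :
    ∃ b < a, (b : ℕ) % 2 = ((u⁻¹ j : Fin n) : ℕ) % 2 ∧ j ≤ v b := by
  by_contra! h
  obtain ⟨i, hi, hni⟩ := exists_inv_apply_notMem v u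
    (Finset.univ.filter fun i : Fin n => i < a ∧ (i : ℕ) % 2 = ((u⁻¹ j : Fin n) : ℕ) % 2) j
    (fun i hi => (h i (Finset.mem_filter.1 hi).2.1 (Finset.mem_filter.1 hi).2.2).ne)
    (by simpa using inv_lt_of_le_apply hD hj hpar ha)
  simp only [Finset.mem_filter, Finset.mem_univ, true_and, not_and] at hi hni
  have hlt := h i hi.1 hi.2
  have hk := ih (v i) hlt
  rw [show v⁻¹ (v i) = i from v.symm_apply_apply i] at hk
  have hle : a ≤ u⁻¹ (v i) := not_lt.1 fun hc => hni hc (hk.trans hi.2)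
  have hne : (a : ℕ) % 2 ≠ ((u⁻¹ (v i) : Fin n) : ℕ) % 2 := by omega
  have hmem : (a, v i) ∈ oddDiagram u :=
    mem_oddDiagram.2 ⟨hlt.trans_le ha, lt_of_le_of_ne hle fun hc => hne (by rw [← hc]), hne⟩
  rw [hD] at hmem
  have := (mem_oddDiagram.1 hmem).2.1
  rw [show v⁻¹ (v i) = i from v.symm_apply_apply i] at this
  exact lt_asymm this hi.1

/-- In an odd diagram class, each value appears in positions of the same parity. -/
theorem same_odd_diagram_positions_same_parity {n : ℕ} (u v : Equiv.Perm (Fin n))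
    (hD : oddDiagram u = oddDiagram v) :
    ∀ i : Fin n, ((u⁻¹ i : Fin n) : ℕ) % 2 = ((v⁻¹ i : Fin n) : ℕ) % 2 := by
  intro j
  induction j using WellFoundedLT.induction with
  | ind j ih =>
  by_contra hj
  have hdesc : ∀ a : Fin n,
      ¬ ((a : ℕ) % 2 = ((v⁻¹ j : Fin n) : ℕ) % 2 ∧ j ≤ u a) := by
    intro a
    induction a using WellFoundedLT.induction with
    | ind a iha =>
    rintro ⟨hpar, ha⟩
    obtain ⟨b, hba, hb, hvb⟩ := exists_apply_ge_before hD ih hj hpar ha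
    obtain ⟨c, hcb, hc⟩ :=
      exists_apply_ge_before hD.symm (fun k hk => (ih k hk).symm) (Ne.symm hj) hb hvb
    exact iha c (hcb.trans hba) hc
  obtain ⟨a, ha⟩ := exists_le_apply_of_parity u v j ih
  exact hdesc a ha
end

section
/- With the standing setup, for every permutation w in the Bruhat interval [u, v] one has w^{-1}(k) ∈ {a_1, a_2, ..., a_m}. -/
open Equiv Finset Polynomial

theorem inv_apply_apply {α : Type*} (f : Equiv.Perm α) (x : α) : f⁻¹ (f x) = x :=
  f.symm_apply_apply x

theorem apply_inv_apply {α : Type*} (f : Equiv.Perm α) (x : α) : f (f⁻¹ x) = x :=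
  f.apply_symm_apply x

/-- Going up in Bruhat order, fewer of the first positions carry small values. -/
theorem bruhatLE.card_le {n : ℕ} {x y : Equiv.Perm (Fin n)} (h : bruhatLE x y) (P Q : Fin n) :
    (univ.filter fun s => s ≤ P ∧ y s ≤ Q).card ≤ (univ.filter fun s => s ≤ P ∧ x s ≤ Q).card := by
  induction h with
  | refl => exact le_rfl
  | @tail z y _ hstep ih =>
    refine le_trans ?_ ih
    obtain ⟨i, j, hij, hz, rfl⟩ := hstep
    by_cases hj : j ≤ P
    · refine card_le_card_of_injOn (swap i j) ?_ (swap i j).injective.injOn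
      intro s hs
      rw [mem_coe, mem_filter_univ] at hs ⊢
      rw [Perm.mul_apply] at hs
      refine ⟨?_, hs.2⟩
      rcases eq_or_ne s i with rfl | h1
      · rwa [swap_apply_left]
      rcases eq_or_ne s j with rfl | h2
      · rw [swap_apply_right]; exact hij.le.trans hj
      · rw [swap_apply_of_ne_of_ne h1 h2]; exact hs.1
    · refine card_le_card fun s hs => ?_
      rw [mem_filter_univ] at hs ⊢
      rw [Perm.mul_apply] at hs
      refine ⟨hs.1, ?_⟩
      have h2 : s ≠ j := by rintro rfl; exact hj hs.1
      rcases eq_or_ne s i with rfl | h1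
      · rw [swap_apply_left] at hs; exact hz.le.trans hs.2
      · rw [swap_apply_of_ne_of_ne h1 h2] at hs; exact hs.2

/-- Going up in Bruhat order, the first value whose position changes moves to the right. -/
theorem bruhatLE.inv_le_inv {n : ℕ} {x y : Equiv.Perm (Fin n)} (h : bruhatLE x y) {k : Fin n}
    (hk : ∀ i < k, x⁻¹ i = y⁻¹ i) : x⁻¹ k ≤ y⁻¹ k := by
  by_contra! hlt
  refine absurd (h.card_le (y⁻¹ k) k) (not_le.2 (card_lt_card ?_))
  rw [ssubset_iff_of_subset]
  · refine ⟨y⁻¹ k, by simp, fun hmem => ?_⟩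
    simp only [mem_filter, mem_univ, true_and, le_refl] at hmem
    rcases hmem.lt_or_eq with h1 | h1
    · have := hk _ h1
      rw [inv_apply_apply, y⁻¹.injective.eq_iff] at this
      exact h1.ne this.symm
    · rw [← h1, inv_apply_apply, h1] at hlt
      exact lt_irrefl _ hlt
  · intro s hs
    simp only [mem_filter, mem_univ, true_and] at hs ⊢
    refine ⟨hs.1, ?_⟩
    rcases hs.2.lt_or_eq with h1 | h1
    · have h2 := hk _ h1
      rw [inv_apply_apply] at h2
      have h3 : y s = x s := by rw [h2, apply_inv_apply, ← h2]
      exact h3 ▸ hs.2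
    · rw [← h1, inv_apply_apply] at hlt
      rw [← h1] at hs
      exact absurd hs.1 (not_le.2 hlt)

theorem mem_oddDiagram_apply {n : ℕ} (w : Equiv.Perm (Fin n)) (i t : Fin n) :
    (i, w t) ∈ oddDiagram w ↔ w t < w i ∧ i < t ∧ (i : ℕ) % 2 ≠ (t : ℕ) % 2 := by
  simp [oddDiagram]

/-- If two permutations have the same odd diagram and agree on the positions of the values below
`k`, then the positions of `k` have the same parity, and the values at positions of the other
parity between them are smaller than `k`. -/
theorem parity_and_lt_of_oddDiagram_eq {n : ℕ} {x y : Equiv.Perm (Fin n)}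
    (h : oddDiagram x = oddDiagram y) {k : Fin n} (hk : ∀ i < k, x⁻¹ i = y⁻¹ i)
    (hlt : x⁻¹ k < y⁻¹ k) :
    ((x⁻¹ k : Fin n) : ℕ) % 2 = ((y⁻¹ k : Fin n) : ℕ) % 2 ∧
      ∀ t, x⁻¹ k < t → t < y⁻¹ k → (t : ℕ) % 2 ≠ ((x⁻¹ k : Fin n) : ℕ) % 2 → x t < k := by
  have key : ∀ t, x⁻¹ k ≤ t → t < y⁻¹ k → (t : ℕ) % 2 ≠ ((y⁻¹ k : Fin n) : ℕ) % 2 → x t < k := by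
    intro t h1 h2 h3
    have hny : (t, k) ∉ oddDiagram y := by
      rw [← h]
      rintro ⟨-, h4, -⟩
      exact absurd h1 (not_le.2 h4)
    have hyt : y t < k := by
      by_contra! hge
      refine hny ⟨hge.lt_of_ne ?_, h2, h3⟩
      rintro rfl
      simp at h2
    have h5 := hk _ hyt
    rw [inv_apply_apply, Perm.inv_eq_iff_eq] at h5
    exact h5 ▸ hyt
  have hpar : ((x⁻¹ k : Fin n) : ℕ) % 2 = ((y⁻¹ k : Fin n) : ℕ) % 2 := by
    by_contra hne
    simpa using key _ le_rfl hlt hne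
  exact ⟨hpar, fun t h1 h2 h3 => key t h1.le h2 (hpar ▸ h3)⟩

/-- Exchanging the values of an inversion at positions of equal parity preserves the odd diagram
if no value at a position of the other parity interferes. -/
theorem oddDiagram_mul_swap {n : ℕ} (u : Equiv.Perm (Fin n)) {p b : Fin n} (hpb : p < b)
    (hinv : u b < u p) (hpar : (p : ℕ) % 2 = (b : ℕ) % 2)
    (hmid : ∀ t, p < t → t < b → (t : ℕ) % 2 ≠ (p : ℕ) % 2 → u t < u b)
    (hright : ∀ t, b < t → (t : ℕ) % 2 ≠ (p : ℕ) % 2 → u b < u t → u p < u t) :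
    oddDiagram (u * swap p b) = oddDiagram u := by
  ext ⟨i, j⟩
  obtain ⟨t, rfl⟩ := u.surjective j
  rw [mem_oddDiagram_apply]
  have hmem : (i, u t) ∈ oddDiagram (u * swap p b) ↔ u t < u (swap p b i) ∧
      i < swap p b t ∧ (i : ℕ) % 2 ≠ ((swap p b t : Fin n) : ℕ) % 2 := by
    have h := mem_oddDiagram_apply (u * swap p b) i (swap p b t)
    rwa [Perm.mul_apply, Perm.mul_apply, swap_apply_self] at h
  rw [hmem]
  generalize hc : (fun x : Fin n => (x : ℕ) % 2) = c
  have hc' : ∀ x : Fin n, (x : ℕ) % 2 = c x := fun x => congrFun hc x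
  simp only [hc'] at *
  clear hmem hc hc'
  have hm := hmid t
  have hr := hright t
  have hmi := hmid i
  have htb := (u.injective.eq_iff (a := t) (b := b)).1
  have htp := (u.injective.eq_iff (a := t) (b := p)).1
  clear hmid hright
  by_cases h1 : t = p
  · subst h1
    rw [swap_apply_left]
    by_cases h2 : i = t
    · subst h2; rw [swap_apply_left]; grind
    by_cases h3 : i = b
    · subst h3; rw [swap_apply_right]; grind
    rw [swap_apply_of_ne_of_ne h2 h3]; grind
  by_cases h1' : t = b
  · subst h1'
    rw [swap_apply_right]
    by_cases h2 : i = p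
    · subst h2; rw [swap_apply_left]; grind
    by_cases h3 : i = t
    · subst h3; rw [swap_apply_right]; grind
    rw [swap_apply_of_ne_of_ne h2 h3]; grind
  rw [swap_apply_of_ne_of_ne h1 h1']
  by_cases h2 : i = p
  · subst h2; rw [swap_apply_left]; grind
  by_cases h3 : i = b
  · subst h3; rw [swap_apply_right]; grind
  rw [swap_apply_of_ne_of_ne h2 h3]

/-- With the standing setup, for every `w ∈ [u, v]` one has `w⁻¹ k ∈ {a₁, …, aₘ}`. -/
theorem position_of_k_in_interval {n : ℕ} (D : Set (Fin n × Fin n)) (u v : Equiv.Perm (Fin n))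
    (hu : oddDiagram u = D) (hv : oddDiagram v = D) (hne : u ≠ v)
    (hint : ∀ w : Equiv.Perm (Fin n), oddDiagram w = D ↔ (bruhatLE u w ∧ bruhatLE w v))
    (k : Fin n) (hk : u⁻¹ k ≠ v⁻¹ k) (hkmin : ∀ i : Fin n, i < k → u⁻¹ i = v⁻¹ i)
    (m : ℕ) (hm : 0 < m) (aseq : Fin m → Fin n) (hmono : StrictMono aseq)
    (hrange : ∀ i : Fin n, (∃ j : Fin m, aseq j = i) ↔
      (u⁻¹ k ≤ i ∧ i ≤ v⁻¹ k ∧ u (u⁻¹ k) ≤ u i ∧ u i ≤ u (v⁻¹ k))) :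
    ∀ w : Equiv.Perm (Fin n), bruhatLE u w → bruhatLE w v →
      ∃ j : Fin m, w⁻¹ k = aseq j := by
  intro w huw hwv
  have hwD : oddDiagram w = D := (hint w).2 ⟨huw, hwv⟩
  have hsame : ∀ i : Fin n, i < k → u⁻¹ i = w⁻¹ i := by
    intro i
    induction i using WellFoundedLT.induction with
    | ind i ih =>
      intro hi
      have h1 := huw.inv_le_inv fun j hj => ih j hj (hj.trans hi)
      have h2 := hwv.inv_le_inv fun j hj =>
        (ih j hj (hj.trans hi)).symm.trans (hkmin j (hj.trans hi))
      exact le_antisymm h1 (h2.trans (hkmin i hi).ge)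
  have hsame' : ∀ i < k, w⁻¹ i = v⁻¹ i := fun i hi => (hsame i hi).symm.trans (hkmin i hi)
  have hap := huw.inv_le_inv hsame
  have hpb := hwv.inv_le_inv hsame'
  have hkle : k ≤ u (w⁻¹ k) := by
    by_contra! hlt
    have h1 := hsame _ hlt
    rw [inv_apply_apply, w⁻¹.injective.eq_iff] at h1
    exact hlt.ne h1.symm
  suffices hle : u (w⁻¹ k) ≤ u (v⁻¹ k) by
    obtain ⟨j, hj⟩ := (hrange (w⁻¹ k)).2 ⟨hap, hpb, by simpa using hkle, hle⟩
    exact ⟨j, hj.symm⟩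
  by_contra! hinv
  have hpb' : w⁻¹ k < v⁻¹ k := hpb.lt_of_ne (by intro h; rw [h] at hinv; exact hinv.false)
  have hab : u⁻¹ k < v⁻¹ k := hap.trans_lt hpb'
  have hkb : k < u (v⁻¹ k) := by
    refine lt_of_le_of_ne (not_lt.1 fun hlt => ?_) fun h => hk (by
      rw [Perm.inv_eq_iff_eq]; exact h)
    have h1 := hkmin _ hlt
    rw [inv_apply_apply, v⁻¹.injective.eq_iff] at h1
    exact hlt.ne h1.symm
  obtain ⟨hpar, -⟩ := parity_and_lt_of_oddDiagram_eq (hwD.trans hv.symm) hsame' hpb'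
  obtain ⟨hpar', hmid⟩ := parity_and_lt_of_oddDiagram_eq (hu.trans hv.symm) hkmin hab
  have hD : oddDiagram (u * swap (w⁻¹ k) (v⁻¹ k)) = D := by
    rw [oddDiagram_mul_swap u hpb' hinv hpar, hu]
    · intro t h1 h2 h3
      exact (hmid t (hap.trans_lt h1) h2 (by rwa [hpar', ← hpar])).trans hkb
    · intro t h1 h2 h3
      by_contra! hle
      have htp : u t < u (w⁻¹ k) :=
        hle.lt_of_ne fun h => (hpb'.trans h1).ne' (u.injective h)
      have hmem : (w⁻¹ k, u t) ∈ oddDiagram w := by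
        rw [hwD, ← hu, mem_oddDiagram_apply]
        exact ⟨htp, hpb'.trans h1, h2.symm⟩
      have hlt : u t < w (w⁻¹ k) := hmem.1
      rw [apply_inv_apply] at hlt
      exact (hkb.trans h3).not_gt hlt
  refine absurd (((hint _).1 hD).1.card_le (w⁻¹ k) (u (v⁻¹ k))) (not_le.2 (card_lt_card ?_))
  rw [ssubset_iff_of_subset]
  · refine ⟨w⁻¹ k, ?_, ?_⟩
    · rw [mem_filter_univ, Perm.mul_apply, swap_apply_left]
      exact ⟨le_rfl, le_rfl⟩
    · rw [mem_filter_univ]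
      exact fun h => h.2.not_gt hinv
  · intro s hs
    rw [mem_filter_univ] at hs ⊢
    rw [Perm.mul_apply]
    refine ⟨hs.1, ?_⟩
    rw [swap_apply_of_ne_of_ne _ (hs.1.trans_lt hpb').ne]
    · exact hs.2
    · rintro rfl
      exact hs.2.not_gt hinv
end
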